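/- Let ψ be a wavelet in L²(ℝ) and let A be a von Neumann algebra of bounded operators on L²(ℝ) with A ⊆ C_ψ(D,T). If U and W are unitary operators belonging to A, then Uψ and Wψ are wavelets, each is core equivalent to ψ, and Uψ and Wψ are core equivalent to each other. -/

import Mathlib

open MeasureTheory
open scoped ComplexInnerProductSpace

noncomputable section

/-- The Hilbert space `L²(ℝ)` of square-integrable complex functions. -/
abbrev H : Type := MeasureTheory.Lp ℂ 2 (MeasureTheory.volume : MeasureTheory.Measure ℝ)

/-- The algebra of bounded operators on `L²(ℝ)`. -/
abbrev B : Type := H →L[ℂ] H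

/-- `ψ` is a wavelet for the dilation `D` and translation `T` if
`{DʲTⁿψ : j, n ∈ ℤ}` is an orthonormal basis of `L²(ℝ)`. -/
def IsWavelet (D T : unitary B) (ψ : H) : Prop :=
  Orthonormal ℂ (fun p : ℤ × ℤ =>
    ((D ^ p.1 : unitary B) : B) (((T ^ p.2 : unitary B) : B) ψ)) ∧
  (Submodule.span ℂ (Set.range fun p : ℤ × ℤ =>
    ((D ^ p.1 : unitary B) : B) (((T ^ p.2 : unitary B) : B) ψ))).topologicalClosure = ⊤

/-- The local commutant `C_ψ(D,T)`. -/
def localCommutant (D T : unitary B) (ψ : H) : Set B :=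
  {V : B | ∀ n l : ℤ,
    V (((D ^ n : unitary B) : B) (((T ^ l : unitary B) : B) ψ)) =
      ((D ^ n : unitary B) : B) (((T ^ l : unitary B) : B) (V ψ))}

/-- The core space `V₀^ψ`: the closed linear span of `{DⁿTˡψ : n < 0, l ∈ ℤ}`. -/
def coreSpace (D T : unitary B) (ψ : H) : Submodule ℂ H :=
  (Submodule.span ℂ {x : H | ∃ n l : ℤ, n < 0 ∧
    x = ((D ^ n : unitary B) : B) (((T ^ l : unitary B) : B) ψ)}).topologicalClosure

/-- Two wavelets `ψ, η` are core equivalent if there is a unitary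
`S : V₀^ψ → V₀^η` intertwining the translation `T`: `S(Tx) = T(Sx)`. -/
def CoreEquivalent (D T : unitary B) (ψ η : H) : Prop :=
  ∃ S : (coreSpace D T ψ) ≃ₗᵢ[ℂ] (coreSpace D T η),
    ∀ x y : coreSpace D T ψ, (y : H) = (T : B) (x : H) →
      ((S y : H) = (T : B) (S x : H))

theorem translation_mul_dilation (D T : unitary B)
    (hD : ∀ f : H, ⇑((D : B) f) =ᵐ[volume] fun x : ℝ => (Real.sqrt 2 : ℂ) * f (2 * x))
    (hT : ∀ f : H, ⇑((T : B) f) =ᵐ[volume] fun x : ℝ => f (x + 1)) :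
    T * D = D * T ^ 2 := by
  have hshift : Measure.QuasiMeasurePreserving (fun x : ℝ => x + 1) volume volume :=
    (measurePreserving_add_right volume (1 : ℝ)).quasiMeasurePreserving
  have hscale : Measure.QuasiMeasurePreserving (fun x : ℝ => 2 * x) volume volume :=
    Measure.quasiMeasurePreserving_smul volume (two_ne_zero : (2 : ℝ) ≠ 0)
  ext f : 2
  apply Lp.ext
  have h₁ := hshift.ae (hD f)
  have h₂ := hscale.ae (hT ((T : B) f))
  have h₃ := hscale.ae (hshift.ae (hT f))
  have e : ((D * T ^ 2 : unitary B) : B) f = (D : B) ((T : B) ((T : B) f)) := by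
    simp [pow_two]
  have e' : ((T * D : unitary B) : B) f = (T : B) ((D : B) f) := rfl
  rw [e, e']
  filter_upwards [hT ((D : B) f), hD ((T : B) ((T : B) f)), h₁, h₂, h₃] with x a b c d g
  rw [a, b, c, d, g]
  ring_nf

theorem exists_semiconjBy_zpow {G : Type*} [Group G] {D T : G} (h : T * D = D * T ^ 2)
    {n : ℤ} (hn : 0 ≤ n) : ∃ m : ℤ, SemiconjBy (D ^ n) (T ^ m) T := by
  lift n to ℕ using hn
  induction n with
  | zero => exact ⟨1, by simp [SemiconjBy]⟩
  | succ n ih =>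
    obtain ⟨m, hm⟩ := ih
    refine ⟨2 * m, ?_⟩
    have hD : SemiconjBy D (T ^ (2 * m)) (T ^ m) := by
      rw [zpow_mul]
      exact SemiconjBy.zpow_right (show D * T ^ (2 : ℤ) = T * D from mod_cast h.symm) m
    have := hm.mul_left hD
    rwa [← zpow_add_one] at this

theorem commute_starProjection (M : Submodule ℂ H) [M.HasOrthogonalProjection] (f : B)
    (hf : ∀ x ∈ M, f x ∈ M) (hf' : ∀ x ∈ M, star f x ∈ M) : Commute M.starProjection f := by
  ext1 x
  refine (Submodule.eq_starProjection_of_mem_orthogonal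
    (hf _ (M.starProjection_apply_mem x)) ?_)
  change f x - f (M.starProjection x) ∈ Mᗮ
  rw [← map_sub, Submodule.mem_orthogonal]
  intro u hu
  rw [← ContinuousLinearMap.adjoint_inner_left]
  exact Submodule.sub_starProjection_mem_orthogonal x _ (hf' u hu)

theorem IsWavelet.map {D T : unitary B} {ψ : H} (hψ : IsWavelet D T ψ) {U : B}
    (hU : U ∈ unitary B) (hUψ : U ∈ localCommutant D T ψ) : IsWavelet D T (U ψ) := by
  let e := Unitary.linearIsometryEquiv ⟨U, hU⟩
  have he : (fun p : ℤ × ℤ => ((D ^ p.1 : unitary B) : B) (((T ^ p.2 : unitary B) : B) (U ψ))) =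
      e ∘ fun p : ℤ × ℤ => ((D ^ p.1 : unitary B) : B) (((T ^ p.2 : unitary B) : B) ψ) :=
    funext fun p => (hUψ p.1 p.2).symm
  refine ⟨?_, ?_⟩
  · rw [he]
    exact hψ.1.comp_linearIsometryEquiv e
  · rw [he, Set.range_comp, ← Submodule.dense_iff_topologicalClosure_eq_top]
    have h := Submodule.dense_iff_topologicalClosure_eq_top.mpr hψ.2
    have h' := e.surjective.denseRange.dense_image e.continuous h
    have hs := Submodule.span_image (R := ℂ) (e.toLinearEquiv : H →ₗ[ℂ] H) (s := Set.range
      fun p : ℤ × ℤ => ((D ^ p.1 : unitary B) : B) (((T ^ p.2 : unitary B) : B) ψ))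
    exact (congrArg (fun K : Submodule ℂ H => Dense (K : Set H)) hs).mpr h'

/-- The core space of a wavelet is the orthogonal complement of the nonnegative scales. -/
theorem IsWavelet.mem_coreSpace_iff {D T : unitary B} {ψ : H} (hψ : IsWavelet D T ψ) (x : H) :
    x ∈ coreSpace D T ψ ↔ ∀ n l : ℤ, 0 ≤ n →
      ⟪((D ^ n : unitary B) : B) (((T ^ l : unitary B) : B) ψ), x⟫ = 0 := by
  constructor
  · intro hx n l hn
    set g := ((D ^ n : unitary B) : B) (((T ^ l : unitary B) : B) ψ)
    have hle : coreSpace D T ψ ≤ (ℂ ∙ g)ᗮ := by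
      refine Submodule.topologicalClosure_minimal _ (Submodule.span_le.mpr ?_)
        (Submodule.isClosed_orthogonal _)
      rintro _ ⟨k, j, hk, rfl⟩
      exact Submodule.mem_orthogonal_singleton_iff_inner_right.mpr
        (hψ.1.2 (i := (n, l)) (j := (k, j)) (by simp; omega))
    exact Submodule.mem_orthogonal_singleton_iff_inner_right.mp (hle hx)
  · intro hx
    let b := HilbertBasis.mk hψ.1 hψ.2.ge
    have hb : ∀ p : ℤ × ℤ, b p =
        ((D ^ p.1 : unitary B) : B) (((T ^ p.2 : unitary B) : B) ψ) :=
      fun p => congrFun (HilbertBasis.coe_mk hψ.1 hψ.2.ge) p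
    refine (Submodule.isClosed_topologicalClosure _).mem_of_tendsto (b.hasSum_repr x)
      (Filter.Eventually.of_forall fun s => Submodule.sum_mem _ fun p _ => ?_)
    rw [b.repr_apply_apply, hb]
    rcases lt_or_ge p.1 0 with hp | hp
    · exact Submodule.smul_mem _ _
        (Submodule.le_topologicalClosure _ (Submodule.subset_span ⟨p.1, p.2, hp, rfl⟩))
    · rw [hx _ _ hp, zero_smul]
      exact Submodule.zero_mem _

theorem coreEquivalent_of_unitary {D T : unitary B} {ψ η : H} (S : unitary B)
    (hST : S * T = T * S) (hS : ∀ x, (S : B) x ∈ coreSpace D T η ↔ x ∈ coreSpace D T ψ) :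
    CoreEquivalent D T ψ η := by
  let e := Unitary.linearIsometryEquiv S
  have hmap : (coreSpace D T ψ).map (e.toLinearEquiv : H →ₗ[ℂ] H) = coreSpace D T η := by
    ext y
    obtain ⟨x, rfl⟩ := e.surjective y
    constructor
    · rintro ⟨z, hz, hzx⟩
      obtain rfl := e.injective hzx
      exact (hS z).mpr hz
    · exact fun h => ⟨x, (hS x).mp h, rfl⟩
  refine ⟨(e.submoduleMap (coreSpace D T ψ)).trans (LinearIsometryEquiv.ofEq _ _ hmap), ?_⟩
  intro x y hxy
  change (S : B) y = (T : B) ((S : B) x)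
  rw [hxy]
  exact congrArg (fun V : unitary B => (V : B) x) hST

/-- A unitary of a von Neumann algebra inside the local commutant can be replaced by one that
commutes with the translation and acts in the same way on the nonnegative scales. -/
theorem exists_unitary_commute_translation {D T : unitary B} (hTD : T * D = D * T ^ 2) {ψ : H}
    {A : VonNeumannAlgebra H} (hA : (A : Set B) ⊆ localCommutant D T ψ)
    {U : B} (hUA : U ∈ A) (hUu : U ∈ unitary B) :
    ∃ S : unitary B, S * T = T * S ∧ ∀ n l : ℤ, 0 ≤ n →
      (S : B) (((D ^ n : unitary B) : B) (((T ^ l : unitary B) : B) ψ)) =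
        ((D ^ n : unitary B) : B) (((T ^ l : unitary B) : B) (U ψ)) := by
  let s : Set H := {x | ∃ V ∈ A, ∃ n l : ℤ, 0 ≤ n ∧
    x = ((D ^ n : unitary B) : B) (((T ^ l : unitary B) : B) (V ψ))}
  let M := (Submodule.span ℂ s).topologicalClosure
  have : CompleteSpace M := (Submodule.isClosed_topologicalClosure _).completeSpace_coe
  have hsM : s ⊆ M := fun x hx => Submodule.le_topologicalClosure _ (Submodule.subset_span hx)
  have hM {f : B} (hf : ∀ x ∈ s, f x ∈ s) : ∀ x ∈ M, f x ∈ M := by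
    have : M ≤ M.comap (f : H →ₗ[ℂ] H) :=
      Submodule.topologicalClosure_minimal _ (Submodule.span_le.mpr fun x hx => hsM (hf x hx))
        ((Submodule.isClosed_topologicalClosure _).preimage f.continuous)
    exact fun x hx => this hx
  have hVs {V W : B} (hV : V ∈ A) (hW : W ∈ A) (n l : ℤ) :
      V (((D ^ n : unitary B) : B) (((T ^ l : unitary B) : B) (W ψ))) =
        ((D ^ n : unitary B) : B) (((T ^ l : unitary B) : B) ((V * W) ψ)) := by
    rw [← hA hW n l]
    exact hA (mul_mem hV hW) n l
  have hAs {V : B} (hV : V ∈ A) : ∀ x ∈ s, V x ∈ s := by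
    rintro _ ⟨W, hW, n, l, hn, rfl⟩
    exact ⟨V * W, mul_mem hV hW, n, l, hn, hVs hV hW n l⟩
  have hTs {n : ℤ} (hn : 0 ≤ n) : ∃ m : ℤ, ∀ (l : ℤ) (y : H),
      (T : B) (((D ^ n : unitary B) : B) (((T ^ l : unitary B) : B) y)) =
        ((D ^ n : unitary B) : B) (((T ^ (m + l) : unitary B) : B) y) ∧
      ((T⁻¹ : unitary B) : B) (((D ^ n : unitary B) : B) (((T ^ l : unitary B) : B) y)) =
        ((D ^ n : unitary B) : B) (((T ^ (-m + l) : unitary B) : B) y) := by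
    obtain ⟨m, hm⟩ := exists_semiconjBy_zpow hTD hn
    refine ⟨m, fun l y => ⟨?_, ?_⟩⟩
    · have : T * (D ^ n * T ^ l) = D ^ n * T ^ (m + l) := by
        rw [zpow_add, ← mul_assoc, ← mul_assoc, hm.eq]
      exact congrArg (fun V : unitary B => (V : B) y) this
    · have : T⁻¹ * (D ^ n * T ^ l) = D ^ n * T ^ (-m + l) := by
        rw [zpow_add, zpow_neg, ← mul_assoc, ← mul_assoc, hm.inv_right.eq]
      exact congrArg (fun V : unitary B => (V : B) y) this
  let Q : B := M.starProjection
  have hQs : star Q = Q := isSelfAdjoint_starProjection M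
  have hQQ : Q * Q = Q := M.isIdempotentElem_starProjection
  have hQU : Q * U = U * Q := (commute_starProjection M U (hM (hAs hUA))
    (hM (hAs (star_mem hUA)))).eq
  have hQU' : Q * star U = star U * Q := by
    have := congrArg star hQU
    rw [star_mul, star_mul, hQs] at this
    exact this.symm
  have hQT : Q * T = T * Q := by
    refine (commute_starProjection M T (hM ?_) (hM (f := ((T⁻¹ : unitary B) : B)) ?_)).eq
    · rintro _ ⟨W, hW, n, l, hn, rfl⟩
      obtain ⟨m, hm⟩ := hTs hn
      exact ⟨W, hW, n, m + l, hn, (hm l _).1⟩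
    · rintro _ ⟨W, hW, n, l, hn, rfl⟩
      obtain ⟨m, hm⟩ := hTs hn
      exact ⟨W, hW, n, -m + l, hn, (hm l _).2⟩
  have hUT : U * T * Q = T * U * Q := by
    ext1 x
    have hle : M ≤ LinearMap.eqLocus ((U * T : B) : H →ₗ[ℂ] H) ((T * U : B) : H →ₗ[ℂ] H) := by
      refine Submodule.topologicalClosure_minimal _ (Submodule.span_le.mpr ?_)
        (isClosed_eq (U * T : B).continuous (T * U : B).continuous)
      rintro _ ⟨W, hW, n, l, hn, rfl⟩
      obtain ⟨m, hm⟩ := hTs hn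
      change U ((T : B) _) = (T : B) (U _)
      rw [(hm l _).1, hVs hUA hW, hVs hUA hW, (hm l _).1]
    exact hle (M.starProjection_apply_mem x)
  have hUU := Unitary.star_mul_self_of_mem hUu
  have hUU' := Unitary.mul_star_self_of_mem hUu
  have hstar : star (U * Q + (1 - Q)) = star U * Q + (1 - Q) := by
    rw [star_add, star_mul, star_sub, star_one, hQs, hQU']
  have key {V W : B} (hVW : V * W = 1) (hQW : Q * W = W * Q) :
      (V * Q + (1 - Q)) * (W * Q + (1 - Q)) = 1 := by
    have h₁ : V * Q * (W * Q) = Q := by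
      rw [← hQW, mul_assoc, ← mul_assoc Q, hQQ, hQW, ← mul_assoc, hVW, one_mul]
    have h₂ : V * Q * (1 - Q) = 0 := by rw [mul_assoc, mul_sub, hQQ, mul_one, sub_self, mul_zero]
    have h₃ : (1 - Q) * (W * Q) = 0 := by
      rw [← hQW, ← mul_assoc, sub_mul, hQQ, one_mul, sub_self, zero_mul]
    have h₄ : (1 - Q) * (1 - Q) = 1 - Q := M.isIdempotentElem_starProjection.one_sub
    rw [add_mul, mul_add, mul_add, h₁, h₂, h₃, h₄]
    abel
  refine ⟨⟨U * Q + (1 - Q), ?_⟩, ?_, ?_⟩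
  · rw [Unitary.mem_iff, hstar]
    exact ⟨key hUU hQU, key hUU' hQU'⟩
  · apply Subtype.ext
    change (U * Q + (1 - Q)) * (T : B) = (T : B) * (U * Q + (1 - Q))
    rw [add_mul, mul_add, sub_mul, mul_sub, mul_assoc, hQT, ← mul_assoc, hUT, mul_assoc,
      one_mul, mul_one]
  · intro n l hn
    set g := ((D ^ n : unitary B) : B) (((T ^ l : unitary B) : B) ψ)
    have hQg : Q g = g := Submodule.starProjection_eq_self_iff.mpr
      (hsM ⟨1, one_mem A, n, l, hn, rfl⟩)
    rw [← hA hUA n l]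
    change U (Q g) + (g - Q g) = U g
    rw [hQg, sub_self, add_zero]

/-- If a von Neumann algebra `A` is contained in `C_ψ(D,T)`, then for unitaries
`U, W ∈ A` the functions `Uψ` and `Wψ` are wavelets, each core equivalent to `ψ`,
and core equivalent to each other. -/
theorem stmt_7
    (D T : unitary B)
    (hD : ∀ f : H, ⇑((D : B) f) =ᵐ[MeasureTheory.volume]
      fun x : ℝ => (Real.sqrt 2 : ℂ) * f (2 * x))
    (hT : ∀ f : H, ⇑((T : B) f) =ᵐ[MeasureTheory.volume] fun x : ℝ => f (x + 1))
    (ψ : H) (hψ : IsWavelet D T ψ)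
    (A : VonNeumannAlgebra H) (hA : (A : Set B) ⊆ localCommutant D T ψ)
    (U W : B) (hUA : U ∈ A) (hUu : U ∈ unitary B) (hWA : W ∈ A) (hWu : W ∈ unitary B) :
    (IsWavelet D T (U ψ) ∧ IsWavelet D T (W ψ)) ∧
    (CoreEquivalent D T (U ψ) ψ ∧ CoreEquivalent D T (W ψ) ψ) ∧
    CoreEquivalent D T (U ψ) (W ψ) := by
  have hTD := translation_mul_dilation D T hD hT
  have hUψ := hψ.map hUu (hA hUA)
  have hWψ := hψ.map hWu (hA hWA)
  obtain ⟨S, hST, hS⟩ := exists_unitary_commute_translation hTD hA hUA hUu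
  obtain ⟨R, hRT, hR⟩ := exists_unitary_commute_translation hTD hA hWA hWu
  have hScore (x : H) : (S : B) x ∈ coreSpace D T (U ψ) ↔ x ∈ coreSpace D T ψ := by
    rw [hUψ.mem_coreSpace_iff, hψ.mem_coreSpace_iff]
    refine forall₂_congr fun n l => forall_congr' fun hn => ?_
    rw [← hS n l hn, Unitary.inner_map_map]
  have hRcore (x : H) : (R : B) x ∈ coreSpace D T (W ψ) ↔ x ∈ coreSpace D T ψ := by
    rw [hWψ.mem_coreSpace_iff, hψ.mem_coreSpace_iff]
    refine forall₂_congr fun n l => forall_congr' fun hn => ?_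
    rw [← hR n l hn, Unitary.inner_map_map]
  have hinv {V : unitary B} {η : H}
      (h : ∀ x, (V : B) x ∈ coreSpace D T η ↔ x ∈ coreSpace D T ψ) (x : H) :
      ((V⁻¹ : unitary B) : B) x ∈ coreSpace D T ψ ↔ x ∈ coreSpace D T η := by
    rw [← h]
    have : (V : B) (((V⁻¹ : unitary B) : B) x) = x :=
      congrArg (fun Z : unitary B => (Z : B) x) (mul_inv_cancel V)
    rw [this]
  have hS' : Commute S⁻¹ T := Commute.inv_left hST
  refine ⟨⟨hUψ, hWψ⟩, ⟨coreEquivalent_of_unitary S⁻¹ hS'.eq (hinv hScore),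
    coreEquivalent_of_unitary R⁻¹ (Commute.inv_left hRT).eq (hinv hRcore)⟩,
    coreEquivalent_of_unitary (R * S⁻¹) (Commute.mul_left hRT hS').eq fun x => ?_⟩
  exact (hRcore _).trans (hinv hScore x)

end
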